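/- Assume q_0 is supported in the Euclidean ball {y ∈ ℝ^d : ‖y‖₂ ≤ √d}. Then there is a universal constant C > 0 such that for every t > 0, E_{X ~ q_t}[ ‖v_t(X)‖₂² ] ≤ C d³ σ_t^{−6}, where v_t(x) ∈ ℝ^d is the vector with i-th entry v_t(x)_i = Σ_{j=1}^d ∂_{x_j} ∂_{x_j} ∂_{x_i} log q_t(x), i.e. the gradient of the Laplacian of log q_t at x. -/

import Mathlib

open MeasureTheory ProbabilityTheory Real

noncomputable section

abbrev Vec (d : ℕ) := EuclideanSpace ℝ (Fin d)

def stdGaussian (d : ℕ) : Measure (Vec d) :=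
  Measure.map (⇑(EuclideanSpace.equiv (Fin d) ℝ).symm)
    (Measure.pi fun _ : Fin d => gaussianReal 0 1)

/-- The law `q_u` of `e^{-u} θ + √(1 - e^{-2u}) g`, with `θ ~ q0` and `g ~ N(0, I_d)`
independent. -/
def forwardLaw {d : ℕ} (q0 : Measure (Vec d)) (u : ℝ) : Measure (Vec d) :=
  Measure.map (fun p : Vec d × Vec d =>
      Real.exp (-u) • p.1 + Real.sqrt (1 - Real.exp (-2*u)) • p.2)
    (q0.prod (stdGaussian d))

/-- Gaussian weight `exp(-‖x - λ_t θ‖² / (2σ_t²))`. -/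
def weight {d : ℕ} (t : ℝ) (x θ : Vec d) : ℝ :=
  Real.exp (-‖x - Real.exp (-t) • θ‖^2 / (2 * (1 - Real.exp (-2*t))))

/-- The conditional law `μ_{t,x}` of `θ` given `λ_t θ + σ_t g = x`:
`dμ_{t,x}(θ) = Z_{t,x}⁻¹ exp(-‖x - λ_t θ‖²/(2σ_t²)) dq0(θ)`. -/
def condMeasure {d : ℕ} (q0 : Measure (Vec d)) (t : ℝ) (x : Vec d) : Measure (Vec d) :=
  (∫⁻ θ, ENNReal.ofReal (weight t x θ) ∂q0)⁻¹ •
    q0.withDensity fun θ => ENNReal.ofReal (weight t x θ)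

/-- The conditional mean `m(t, x) = E_{t,x}[θ]`. -/
def condMean {d : ℕ} (q0 : Measure (Vec d)) (t : ℝ) (x : Vec d) : Vec d :=
  ∫ θ, θ ∂(condMeasure q0 t x)

/-- Partial derivative in the `i`-th coordinate direction. -/
def pd {d : ℕ} (i : Fin d) (f : Vec d → ℝ) (x : Vec d) : ℝ :=
  fderiv ℝ f x (EuclideanSpace.single i 1)


/-- Density of the centred Gaussian law on `ℝ^d` with covariance `v • I`. -/
def gaussianVecPDF {d : ℕ} (v : NNReal) (y : Vec d) : ℝ :=
  ∏ i, gaussianPDFReal 0 v (y i)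

lemma gaussianVecPDF_nonneg {d : ℕ} (v : NNReal) (y : Vec d) : 0 ≤ gaussianVecPDF v y :=
  Finset.prod_nonneg fun _ _ => gaussianPDFReal_nonneg _ _ _

lemma gaussianVecPDF_eq {d : ℕ} (v : NNReal) (y : Vec d) :
    gaussianVecPDF v y = (√(2 * π * v))⁻¹ ^ d * exp (-‖y‖ ^ 2 / (2 * v)) := by
  simp only [gaussianVecPDF, gaussianPDFReal, sub_zero, Finset.prod_mul_distrib,
    Finset.prod_const, Finset.card_univ, Fintype.card_fin, ← exp_sum, EuclideanSpace.norm_sq_eq,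
    Real.norm_eq_abs, sq_abs, ← Finset.sum_div, Finset.sum_neg_distrib]

lemma continuous_gaussianVecPDF {d : ℕ} (v : NNReal) :
    Continuous (gaussianVecPDF v : Vec d → ℝ) := by
  simp only [funext (gaussianVecPDF_eq (d := d) v)]
  fun_prop

lemma pi_gaussianReal_eq_withDensity {ι : Type*} [Fintype ι] {v : NNReal} (hv : v ≠ 0) :
    Measure.pi (fun _ : ι => gaussianReal 0 v) =
      volume.withDensity fun x => ENNReal.ofReal (∏ i, gaussianPDFReal 0 v (x i)) := by
  refine Measure.pi_eq fun s hs => ?_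
  have hbox : MeasurableSet (Set.univ.pi s) := MeasurableSet.univ_pi hs
  have hind : ∀ x : ι → ℝ, (Set.univ.pi s).indicator
      (fun x => ENNReal.ofReal (∏ i, gaussianPDFReal 0 v (x i))) x =
      ENNReal.ofReal (∏ i, (s i).indicator (gaussianPDFReal 0 v) (x i)) := by
    intro x
    by_cases hx : x ∈ Set.univ.pi s
    · rw [Set.indicator_of_mem hx]
      congr 1
      exact Finset.prod_congr rfl fun i _ => (Set.indicator_of_mem (hx i trivial) _).symm
    · rw [Set.indicator_of_notMem hx]
      obtain ⟨i, hi⟩ : ∃ i, x i ∉ s i := by simpa [Set.mem_pi] using hx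
      rw [Finset.prod_eq_zero (Finset.mem_univ i) (Set.indicator_of_notMem hi _),
        ENNReal.ofReal_zero]
  have hint : ∀ i, Integrable ((s i).indicator (gaussianPDFReal 0 v)) volume :=
    fun i => (integrable_gaussianPDFReal 0 v).indicator (hs i)
  have hnn : ∀ i x, 0 ≤ (s i).indicator (gaussianPDFReal 0 v) x :=
    fun i x => Set.indicator_nonneg (fun y _ => gaussianPDFReal_nonneg 0 v y) x
  rw [withDensity_apply _ hbox, ← lintegral_indicator hbox, lintegral_congr hind, volume_pi,
    ← ofReal_integral_eq_lintegral_ofReal (Integrable.fintype_prod hint)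
      (ae_of_all _ fun x => Finset.prod_nonneg fun i _ => hnn i _),
    integral_fintype_prod_eq_prod,
    ENNReal.ofReal_prod_of_nonneg fun i _ => integral_nonneg (hnn i)]
  refine Finset.prod_congr rfl fun i _ => ?_
  rw [integral_indicator (hs i), gaussianReal_apply_eq_integral 0 hv]

lemma map_smul_stdGaussian {d : ℕ} {v : NNReal} (hv : v ≠ 0) :
    (_root_.stdGaussian d).map (fun y => √(v : ℝ) • y) =
      volume.withDensity fun y => ENNReal.ofReal (gaussianVecPDF v y) := by
  have hpi : (Measure.pi fun _ : Fin d => gaussianReal 0 1).map (fun x i => √(v : ℝ) * x i) =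
      Measure.pi fun _ : Fin d => gaussianReal 0 v := by
    rw [Measure.pi_map_pi (f := fun _ x => √(v : ℝ) * x) (fun i => by fun_prop)]
    congr 1
    ext1 i
    rw [gaussianReal_map_const_mul]
    congr 1
    · simp
    · ext; simp
  have hcomm : (fun y : Vec d => √(v : ℝ) • y) ∘ ⇑(EuclideanSpace.equiv (Fin d) ℝ).symm =
      (MeasurableEquiv.toLp 2 (Fin d → ℝ)) ∘ (fun x i => √(v : ℝ) * x i) := by
    ext x i
    simp
  rw [_root_.stdGaussian, Measure.map_map (by fun_prop)
    (EuclideanSpace.equiv (Fin d) ℝ).symm.continuous.measurable, hcomm,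
    ← Measure.map_map (MeasurableEquiv.measurable _) (by fun_prop), hpi,
    pi_gaussianReal_eq_withDensity hv]
  ext s hs
  have hpdf : Measurable fun y : Vec d => ENNReal.ofReal (gaussianVecPDF v y) :=
    (continuous_gaussianVecPDF v).measurable.ennreal_ofReal
  have hmp := PiLp.volume_preserving_toLp (Fin d)
  rw [Measure.map_apply (MeasurableEquiv.measurable _) hs,
    withDensity_apply _ (MeasurableEquiv.measurable _ hs), withDensity_apply _ hs,
    ← hmp.setLIntegral_comp_preimage hs hpdf]
  rfl

lemma lintegral_forwardLaw {d : ℕ} (q0 : Measure (Vec d)) [SFinite q0] {t : ℝ} {v : NNReal}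
    (hv : v ≠ 0) (hvt : (v : ℝ) = 1 - exp (-2 * t)) {F : Vec d → ENNReal} (hF : Measurable F) :
    ∫⁻ x, F x ∂(forwardLaw q0 t) =
      ∫⁻ x, F x * ∫⁻ θ, ENNReal.ofReal (gaussianVecPDF v (x - exp (-t) • θ)) ∂q0 := by
  have hpdf : Measurable fun y : Vec d => ENNReal.ofReal (gaussianVecPDF v y) :=
    (continuous_gaussianVecPDF v).measurable.ennreal_ofReal
  have : IsProbabilityMeasure (_root_.stdGaussian d) :=
    Measure.isProbabilityMeasure_map
      (EuclideanSpace.equiv (Fin d) ℝ).symm.continuous.measurable.aemeasurable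
  rw [forwardLaw, lintegral_map hF (by fun_prop), lintegral_prod _ (by fun_prop)]
  simp only [← hvt]
  have hinner : ∀ θ : Vec d,
      ∫⁻ g, F (exp (-t) • θ + √(v : ℝ) • g) ∂(_root_.stdGaussian d) =
        ∫⁻ x, F x * ENNReal.ofReal (gaussianVecPDF v (x - exp (-t) • θ)) := by
    intro θ
    rw [← lintegral_map (f := fun y => F (exp (-t) • θ + y)) (μ := _root_.stdGaussian d)
      (g := fun y => √(v : ℝ) • y) (by fun_prop) (by fun_prop), map_smul_stdGaussian hv,
      lintegral_withDensity_eq_lintegral_mul _ hpdf (by fun_prop),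
      ← lintegral_add_left_eq_self
        (fun x => F x * ENNReal.ofReal (gaussianVecPDF v (x - exp (-t) • θ))) (exp (-t) • θ)]
    refine lintegral_congr fun y => ?_
    simp [mul_comm]
  simp only [hinner]
  rw [lintegral_lintegral_swap]
  · refine lintegral_congr fun x => ?_
    exact lintegral_const_mul _ (hpdf.comp (by fun_prop))
  · have : Measurable fun p : Vec d × Vec d =>
        F p.2 * ENNReal.ofReal (gaussianVecPDF v (p.2 - exp (-t) • p.1)) :=
      (hF.comp measurable_snd).mul (hpdf.comp (by fun_prop))
    exact this.aemeasurable

lemma forwardLaw_eq_withDensity {d : ℕ} (q0 : Measure (Vec d)) [SFinite q0] {t : ℝ} {v : NNReal}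
    (hv : v ≠ 0) (hvt : (v : ℝ) = 1 - exp (-2 * t)) :
    forwardLaw q0 t = volume.withDensity fun x =>
      ∫⁻ θ, ENNReal.ofReal (gaussianVecPDF v (x - exp (-t) • θ)) ∂q0 := by
  ext s hs
  rw [← lintegral_indicator_one hs,
    lintegral_forwardLaw q0 hv hvt (measurable_one.indicator hs), withDensity_apply _ hs,
    ← lintegral_indicator hs]
  refine lintegral_congr fun x => ?_
  by_cases hx : x ∈ s <;> simp [hx]

lemma gaussian_sixth_moment_norm {d : ℕ} {v : NNReal} (hv : v ≠ 0) :
    ∫⁻ y : Vec d, ENNReal.ofReal (‖y‖ ^ 6 * gaussianVecPDF v y) ≤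
      ENNReal.ofReal ((v : ℝ) ^ 3 * ((d : ℝ) ^ 3 * ∫ x, x ^ 6 ∂(gaussianReal 0 1))) := by
  have hpdf : Measurable fun y : Vec d => ENNReal.ofReal (gaussianVecPDF v y) :=
    (continuous_gaussianVecPDF v).measurable.ennreal_ofReal
  have hint : Integrable (fun x : ℝ => x ^ 6) (gaussianReal 0 1) := by
    have h := (memLp_id_gaussianReal' (μ := 0) (v := 1) 6 (by simp)).integrable_norm_pow (by simp)
    refine h.congr (ae_of_all _ fun x => ?_)
    simp only [id, Real.norm_eq_abs]
    exact Even.pow_abs ⟨3, rfl⟩ x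
  have hcoord : ∀ i : Fin d, Integrable (fun x : Fin d → ℝ => x i ^ 6)
      (Measure.pi fun _ : Fin d => gaussianReal 0 1) := fun i =>
    (measurePreserving_eval (fun _ : Fin d => gaussianReal 0 1) i).integrable_comp_of_integrable hint
  have hpow : ∀ x : Fin d → ℝ, (∑ i, x i ^ 2) ^ 3 ≤ (d : ℝ) ^ 2 * ∑ i, x i ^ 6 := by
    intro x
    rcases Nat.eq_zero_or_pos d with rfl | hd
    · simp
    have := pow_sum_div_card_le_sum_pow (s := Finset.univ) (f := fun i => x i ^ 2)
      (fun i _ => sq_nonneg _) 2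
    rw [Finset.card_univ, Fintype.card_fin, div_le_iff₀ (by positivity)] at this
    simpa [← pow_mul, mul_comm] using this
  calc ∫⁻ y : Vec d, ENNReal.ofReal (‖y‖ ^ 6 * gaussianVecPDF v y)
      = ∫⁻ y : Vec d, ENNReal.ofReal (‖y‖ ^ 6) ∂((_root_.stdGaussian d).map
          (fun y => √(v : ℝ) • y)) := by
        rw [map_smul_stdGaussian hv, lintegral_withDensity_eq_lintegral_mul _ hpdf (by fun_prop)]
        refine lintegral_congr fun y => ?_
        rw [ENNReal.ofReal_mul (by positivity), Pi.mul_apply, mul_comm]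
    _ = ∫⁻ x, ENNReal.ofReal ((v : ℝ) ^ 3 * (∑ i, x i ^ 2) ^ 3)
          ∂(Measure.pi fun _ : Fin d => gaussianReal 0 1) := by
        rw [lintegral_map (by fun_prop) (by fun_prop), _root_.stdGaussian, lintegral_map
          (by fun_prop) (EuclideanSpace.equiv (Fin d) ℝ).symm.continuous.measurable]
        refine lintegral_congr fun x => ?_
        rw [norm_smul, mul_pow, show 6 = 2 * 3 from rfl, pow_mul, pow_mul ‖_‖ 2 3,
          EuclideanSpace.norm_sq_eq]
        simp
    _ ≤ ∫⁻ x, ENNReal.ofReal ((v : ℝ) ^ 3 * ((d : ℝ) ^ 2 * ∑ i, x i ^ 6))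
          ∂(Measure.pi fun _ : Fin d => gaussianReal 0 1) := by
        refine lintegral_mono fun x => ENNReal.ofReal_le_ofReal ?_
        gcongr
        exact hpow x
    _ = ENNReal.ofReal ((v : ℝ) ^ 3 * ((d : ℝ) ^ 3 * ∫ x, x ^ 6 ∂(gaussianReal 0 1))) := by
        rw [← ofReal_integral_eq_lintegral_ofReal
          (((integrable_finsetSum _ fun i _ => hcoord i).const_mul _).const_mul _)
          (ae_of_all _ fun x => by positivity), integral_const_mul, integral_const_mul,
          integral_finsetSum _ fun i _ => hcoord i]
        have hval : ∀ i : Fin d, ∫ x : Fin d → ℝ, x i ^ 6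
            ∂(Measure.pi fun _ : Fin d => gaussianReal 0 1) = ∫ x, x ^ 6 ∂(gaussianReal 0 1) :=
          fun i => integral_comp_eval (i := i) (μ := fun _ : Fin d => gaussianReal 0 1)
            (f := fun x : ℝ => x ^ 6) hint.aestronglyMeasurable
        simp only [hval, Finset.sum_const, Finset.card_univ, Fintype.card_fin, nsmul_eq_mul]
        ring_nf

/-- `f` is differentiable at `x` with `i`-th partial derivative `f'`. -/
def HasPd {d : ℕ} (i : Fin d) (f : Vec d → ℝ) (f' : ℝ) (x : Vec d) : Prop :=
  DifferentiableAt ℝ f x ∧ pd i f x = f'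

namespace HasPd

variable {d : ℕ} {i : Fin d} {f g : Vec d → ℝ} {f' g' : ℝ} {x : Vec d}

lemma of_hasFDerivAt {F : Vec d →L[ℝ] ℝ} (h : HasFDerivAt f F x) :
    HasPd i f (F (EuclideanSpace.single i 1)) x :=
  ⟨h.differentiableAt, by rw [pd, h.fderiv]⟩

lemma add (hf : HasPd i f f' x) (hg : HasPd i g g' x) :
    HasPd i (fun y => f y + g y) (f' + g') x :=
  ⟨hf.1.add hg.1, by rw [← hf.2, ← hg.2, pd, fderiv_fun_add hf.1 hg.1]; rfl⟩

lemma sub (hf : HasPd i f f' x) (hg : HasPd i g g' x) :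
    HasPd i (fun y => f y - g y) (f' - g') x :=
  ⟨hf.1.sub hg.1, by rw [← hf.2, ← hg.2, pd, fderiv_fun_sub hf.1 hg.1]; rfl⟩

lemma mul (hf : HasPd i f f' x) (hg : HasPd i g g' x) :
    HasPd i (fun y => f y * g y) (f' * g x + f x * g') x := by
  refine ⟨hf.1.mul hg.1, ?_⟩
  rw [← hf.2, ← hg.2, pd, fderiv_fun_mul hf.1 hg.1]
  simp only [add_apply, smul_apply, smul_eq_mul, pd]
  ring

lemma const (c : ℝ) : HasPd i (fun _ => c) 0 x := by
  simpa using of_hasFDerivAt (i := i) (hasFDerivAt_const c x)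

lemma const_mul (c : ℝ) (hf : HasPd i f f' x) : HasPd i (fun y => c * f y) (c * f') x := by
  simpa using (const c).mul hf

lemma inv (hf : HasPd i f f' x) (h0 : f x ≠ 0) :
    HasPd i (fun y => (f y)⁻¹) (-f' / f x ^ 2) x := by
  have h := of_hasFDerivAt (i := i) ((hasDerivAt_inv h0).comp_hasFDerivAt x hf.1.hasFDerivAt)
  refine ⟨h.1, h.2.trans ?_⟩
  rw [← hf.2, pd, smul_apply, smul_eq_mul]
  ring

lemma log (hf : HasPd i f f' x) (h0 : f x ≠ 0) :
    HasPd i (fun y => Real.log (f y)) (f' / f x) x := by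
  have h := of_hasFDerivAt (i := i) (hf.1.hasFDerivAt.log h0)
  refine ⟨h.1, h.2.trans ?_⟩
  rw [← hf.2, pd, smul_apply, smul_eq_mul]
  ring

lemma coord (k : Fin d) : HasPd i (fun y => y k) (if k = i then 1 else 0) x := by
  have h := of_hasFDerivAt (i := i) (EuclideanSpace.proj (𝕜 := ℝ) k).hasFDerivAt (x := x)
  refine ⟨h.1, h.2.trans ?_⟩
  simp

lemma norm_sq : HasPd i (fun y => ‖y‖ ^ 2) (2 * x i) x := by
  have h := of_hasFDerivAt (i := i) (hasStrictFDerivAt_norm_sq x).hasFDerivAt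
  refine ⟨h.1, h.2.trans ?_⟩
  simp [EuclideanSpace.inner_single_right]

end HasPd

lemma integrable_of_continuous_of_ae_bounded {d : ℕ} {E : Type*} [NormedAddCommGroup E]
    {μ : Measure (Vec d)} [IsFiniteMeasure μ] {B : ℝ} (hB : ∀ᵐ y ∂μ, ‖y‖ ≤ B)
    {f : Vec d → E} (hf : Continuous f) : Integrable f μ := by
  obtain ⟨K, hK⟩ := (isCompact_closedBall (0 : Vec d) B).exists_bound_of_continuousOn hf.continuousOn
  refine Integrable.of_bound hf.aestronglyMeasurable K ?_
  filter_upwards [hB] with y hy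
  exact hK y (by simpa using hy)

/-- The third-order central moment of a probability measure is controlled by its sixth absolute
moment about any point. -/
lemma sum_sq_third_central_moment_le {d : ℕ} (P : Measure (Vec d)) [IsProbabilityMeasure P]
    {B : ℝ} (hB : ∀ᵐ y ∂P, ‖y‖ ≤ B) (a m : Vec d) (hm : ∀ i, m i = ∫ y, y i ∂P) :
    ∑ i, (∫ y, (y i - m i) * ‖y - m‖ ^ 2 ∂P) ^ 2 ≤ 64 * ∫ y, ‖y - a‖ ^ 6 ∂P := by
  have hmean : m = ∫ y, y ∂P := by
    ext i
    rw [hm i]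
    exact (EuclideanSpace.proj (𝕜 := ℝ) i).integral_comp_comm
      (integrable_of_continuous_of_ae_bounded hB continuous_id)
  set w : Vec d := ∫ y, ‖y - m‖ ^ 2 • (y - m) ∂P with hw
  have hwi : ∀ i, w i = ∫ y, (y i - m i) * ‖y - m‖ ^ 2 ∂P := by
    intro i
    refine ((EuclideanSpace.proj (𝕜 := ℝ) i).integral_comp_comm
      (integrable_of_continuous_of_ae_bounded hB
        (f := fun y => ‖y - m‖ ^ 2 • (y - m)) (by fun_prop))).symm.trans ?_
    refine integral_congr_ae (ae_of_all _ fun y => ?_)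
    simp [mul_comm]
  have jensen : ∀ (n : ℕ) (f : Vec d → ℝ), Continuous f → (∀ y, 0 ≤ f y) →
      (∫ y, f y ∂P) ^ n ≤ ∫ y, f y ^ n ∂P := by
    intro n f hf h0
    exact (convexOn_pow n).map_integral_le (continuous_pow n).continuousOn isClosed_Ici
      (ae_of_all _ h0) (integrable_of_continuous_of_ae_bounded hB hf)
      (integrable_of_continuous_of_ae_bounded hB (hf.pow n))
  have hsum : ∑ i, (∫ y, (y i - m i) * ‖y - m‖ ^ 2 ∂P) ^ 2 = ‖w‖ ^ 2 := by
    rw [EuclideanSpace.norm_sq_eq]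
    simp [hwi]
  have hwnorm : ‖w‖ ≤ ∫ y, ‖y - m‖ ^ 3 ∂P := by
    refine (norm_integral_le_integral_norm _).trans_eq ?_
    refine integral_congr_ae (ae_of_all _ fun y => ?_)
    simp only [norm_smul, norm_pow, norm_norm]
    ring
  have hshift : ‖a - m‖ ^ 6 ≤ ∫ y, ‖y - a‖ ^ 6 ∂P := by
    have h1 : m - a = ∫ y, (y - a) ∂P := by
      rw [integral_sub (integrable_of_continuous_of_ae_bounded hB (f := fun y => y) continuous_id)
        (integrable_const a), ← hmean]
      simp
    rw [norm_sub_rev, h1]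
    exact (pow_le_pow_left₀ (norm_nonneg _) (norm_integral_le_integral_norm _) 6).trans
      (jensen 6 (fun y => ‖y - a‖) (by fun_prop) fun y => norm_nonneg _)
  have hpoint : ∀ y, ‖y - m‖ ^ 6 ≤ 32 * (‖y - a‖ ^ 6 + ‖a - m‖ ^ 6) := by
    intro y
    have h2 := add_pow_le (norm_nonneg (y - a)) (norm_nonneg (a - m)) 6
    norm_num at h2
    refine le_trans (pow_le_pow_left₀ (norm_nonneg _) ?_ 6) h2
    simpa using norm_add_le (y - a) (a - m)
  have hint6 : Integrable (fun y => ‖y - a‖ ^ 6) P :=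
    integrable_of_continuous_of_ae_bounded hB (by fun_prop)
  calc ∑ i, (∫ y, (y i - m i) * ‖y - m‖ ^ 2 ∂P) ^ 2
      = ‖w‖ ^ 2 := hsum
    _ ≤ (∫ y, ‖y - m‖ ^ 3 ∂P) ^ 2 := by gcongr
    _ ≤ ∫ y, (‖y - m‖ ^ 3) ^ 2 ∂P :=
        jensen 2 (fun y => ‖y - m‖ ^ 3) (by fun_prop) fun y => by positivity
    _ ≤ ∫ y, 32 * (‖y - a‖ ^ 6 + ‖a - m‖ ^ 6) ∂P := by
        refine integral_mono (integrable_of_continuous_of_ae_bounded hB (by fun_prop))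
          (integrable_of_continuous_of_ae_bounded hB (by fun_prop)) fun y => ?_
        simpa only [← pow_mul] using hpoint y
    _ = 32 * (∫ y, ‖y - a‖ ^ 6 ∂P + ‖a - m‖ ^ 6) := by
        rw [integral_const_mul, integral_add hint6 (integrable_const _)]
        simp
    _ ≤ 64 * ∫ y, ‖y - a‖ ^ 6 ∂P := by linarith

/-- The exponential integral `x ↦ ∫ f(θ) exp(h(θ) + b⟪x, θ⟫) dμ(θ)`. -/
def expIntegral {d : ℕ} (μ : Measure (Vec d)) (h : Vec d → ℝ) (b : ℝ) (f : Vec d → ℝ)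
    (x : Vec d) : ℝ :=
  ∫ θ, f θ * exp (h θ + b * inner ℝ x θ) ∂μ

/-- The measure `μ` tilted by `θ ↦ exp(h(θ) + b⟪x, θ⟫)`. -/
def expTilt {d : ℕ} (μ : Measure (Vec d)) (h : Vec d → ℝ) (b : ℝ) (x : Vec d) :
    Measure (Vec d) :=
  μ.tilted fun θ => h θ + b * inner ℝ x θ

section expTilt

variable {d : ℕ} {μ : Measure (Vec d)} {B : ℝ} {h : Vec d → ℝ} {b : ℝ}
  {f : Vec d → ℝ}

lemma integral_expTilt (f : Vec d → ℝ) (x : Vec d) :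
    ∫ θ, f θ ∂(expTilt μ h b x) =
      expIntegral μ h b f x * (expIntegral μ h b (fun _ => 1) x)⁻¹ := by
  rw [expTilt, integral_tilted, expIntegral, expIntegral, ← integral_mul_const]
  refine integral_congr_ae (ae_of_all _ fun θ => ?_)
  simp only [smul_eq_mul, one_mul]
  ring

variable [IsProbabilityMeasure μ]

lemma hasPd_expIntegral (hB : ∀ᵐ y ∂μ, ‖y‖ ≤ B) (hh : Continuous h) (hf : Continuous f)
    (i : Fin d) (x : Vec d) :
    HasPd i (expIntegral μ h b f) (b * expIntegral μ h b (fun θ => θ i * f θ) x) x := by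
  have hcont : ∀ z, Continuous fun θ : Vec d => f θ * exp (h θ + b * inner ℝ z θ) :=
    fun z => by fun_prop
  have hF'cont : Continuous fun p : Vec d × Vec d =>
      (f p.2 * exp (h p.2 + b * inner ℝ p.1 p.2) * b) • innerSL ℝ p.2 := by fun_prop
  obtain ⟨K, hK⟩ := ((isCompact_closedBall x 1).prod (isCompact_closedBall (0 : Vec d) B)
    ).exists_bound_of_continuousOn hF'cont.continuousOn
  have hmain := hasFDerivAt_integral_of_dominated_of_fderiv_le (μ := μ)
    (F := fun z θ => f θ * exp (h θ + b * inner ℝ z θ))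
    (F' := fun z θ => (f θ * exp (h θ + b * inner ℝ z θ) * b) • innerSL ℝ θ)
    (bound := fun _ => K) (x₀ := x) (Metric.closedBall_mem_nhds x one_pos)
    (Filter.Eventually.of_forall fun z => (hcont z).aestronglyMeasurable)
    (integrable_of_continuous_of_ae_bounded hB (hcont x))
    (Continuous.aestronglyMeasurable (by fun_prop))
    (by
      filter_upwards [hB] with θ hθ z hz
      exact hK (z, θ) ⟨hz, by simpa using hθ⟩)
    (integrable_const _)
    (by
      filter_upwards with θ z _
      have h1 : HasFDerivAt (fun z : Vec d => inner ℝ z θ) (innerSL ℝ θ) z := by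
        refine (innerSL ℝ θ).hasFDerivAt.congr_of_eventuallyEq (.of_forall fun y => ?_)
        simp [real_inner_comm]
      have h2 := (((h1.const_mul b).const_add (h θ)).exp).const_mul (f θ)
      rwa [smul_smul, smul_smul] at h2)
  refine ⟨hmain.differentiableAt, ?_⟩
  have hF'int : Integrable
      (fun θ : Vec d => (f θ * exp (h θ + b * inner ℝ x θ) * b) • innerSL ℝ θ) μ :=
    integrable_of_continuous_of_ae_bounded hB (by fun_prop)
  refine (HasPd.of_hasFDerivAt (i := i) hmain).2.trans ?_
  rw [ContinuousLinearMap.integral_apply hF'int, expIntegral, ← integral_const_mul]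
  refine integral_congr_ae (ae_of_all _ fun θ => ?_)
  simp [EuclideanSpace.inner_single_right]
  ring

lemma integrable_exp_tilt (hB : ∀ᵐ y ∂μ, ‖y‖ ≤ B) (hh : Continuous h) (x : Vec d) :
    Integrable (fun θ => exp (h θ + b * inner ℝ x θ)) μ :=
  integrable_of_continuous_of_ae_bounded hB (by fun_prop)

lemma expIntegral_one_pos (hB : ∀ᵐ y ∂μ, ‖y‖ ≤ B) (hh : Continuous h) (x : Vec d) :
    0 < expIntegral μ h b (fun _ => 1) x := by
  simpa [expIntegral] using integral_exp_pos (integrable_exp_tilt (b := b) hB hh x)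

lemma isProbabilityMeasure_expTilt (hB : ∀ᵐ y ∂μ, ‖y‖ ≤ B) (hh : Continuous h) (x : Vec d) :
    IsProbabilityMeasure (expTilt μ h b x) :=
  isProbabilityMeasure_tilted (integrable_exp_tilt hB hh x)

lemma hasPd_integral_expTilt (hB : ∀ᵐ y ∂μ, ‖y‖ ≤ B) (hh : Continuous h) (hf : Continuous f)
    (i : Fin d) (x : Vec d) :
    HasPd i (fun z => ∫ θ, f θ ∂(expTilt μ h b z))
      (b * (∫ θ, θ i * f θ ∂(expTilt μ h b x) -
        (∫ θ, f θ ∂(expTilt μ h b x)) * ∫ θ, θ i ∂(expTilt μ h b x))) x := by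
  have h0 := (expIntegral_one_pos (b := b) hB hh x).ne'
  have h1 := (hasPd_expIntegral (b := b) hB hh hf i x).mul
    ((hasPd_expIntegral (b := b) hB hh (continuous_const (y := (1 : ℝ))) i x).inv h0)
  simp only [integral_expTilt]
  refine ⟨h1.1, h1.2.trans ?_⟩
  simp only [mul_one]
  field_simp
  ring

lemma hasPd_log_expIntegral (hB : ∀ᵐ y ∂μ, ‖y‖ ≤ B) (hh : Continuous h)
    (i : Fin d) (x : Vec d) :
    HasPd i (fun z => Real.log (expIntegral μ h b (fun _ => 1) z))
      (b * ∫ θ, θ i ∂(expTilt μ h b x)) x := by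
  have h0 := (expIntegral_one_pos (b := b) hB hh x).ne'
  have h1 := (hasPd_expIntegral (b := b) hB hh (continuous_const (y := (1 : ℝ))) i x).log h0
  refine ⟨h1.1, h1.2.trans ?_⟩
  simp only [integral_expTilt, mul_one]
  ring

/-- Third partial derivatives of a quadratic plus a log-partition function are third cumulants of
the tilted measure. -/
lemma pd_pd_pd_quadratic_add_log_expIntegral (hB : ∀ᵐ y ∂μ, ‖y‖ ≤ B) (hh : Continuous h)
    (c k : ℝ) (i j : Fin d) (x m : Vec d) (hm : ∀ i, m i = ∫ y, y i ∂(expTilt μ h b x)) :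
    pd j (pd j (pd i fun z =>
      c + k * ‖z‖ ^ 2 + Real.log (expIntegral μ h b (fun _ => 1) z))) x =
      b ^ 3 * ∫ y, (y i - m i) * (y j - m j) ^ 2 ∂(expTilt μ h b x) := by
  have hcoord : ∀ l : Fin d, Continuous fun θ : Vec d => θ l := fun l => by fun_prop
  have e1 : pd i (fun z => c + k * ‖z‖ ^ 2 + Real.log (expIntegral μ h b (fun _ => 1) z)) =
      fun z => 2 * k * z i + b * ∫ θ, θ i ∂(expTilt μ h b z) := by
    ext z
    rw [(((HasPd.const c).add (HasPd.norm_sq.const_mul k)).add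
      (hasPd_log_expIntegral (b := b) hB hh i z)).2]
    ring
  have e2 : pd j (fun z => 2 * k * z i + b * ∫ θ, θ i ∂(expTilt μ h b z)) =
      fun z => 2 * k * (if i = j then 1 else 0) + b * (b * (∫ θ, θ j * θ i ∂(expTilt μ h b z) -
        (∫ θ, θ i ∂(expTilt μ h b z)) * ∫ θ, θ j ∂(expTilt μ h b z))) := by
    ext z
    rw [(((HasPd.coord i).const_mul (2 * k)).add
      ((hasPd_integral_expTilt (b := b) hB hh (hcoord i) j z).const_mul b)).2]
  rw [e1, e2, ((HasPd.const _).add ((((hasPd_integral_expTilt (b := b) hB hh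
    (f := fun θ => θ j * θ i) (by fun_prop) j x).sub ((hasPd_integral_expTilt (b := b) hB hh (hcoord i) j x).mul
    (hasPd_integral_expTilt (b := b) hB hh (hcoord j) j x))).const_mul b).const_mul b)).2]
  have := isProbabilityMeasure_expTilt (b := b) hB hh x
  have hB' : ∀ᵐ y ∂(expTilt μ h b x), ‖y‖ ≤ B := tilted_absolutelyContinuous _ _ hB
  have hexp : ∫ y, (y i - m i) * (y j - m j) ^ 2 ∂(expTilt μ h b x) =
      ∫ y, y j * (y j * y i) ∂(expTilt μ h b x) - 2 * m j * ∫ y, y j * y i ∂(expTilt μ h b x)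
        + m j ^ 2 * ∫ y, y i ∂(expTilt μ h b x) - m i * ∫ y, y j * y j ∂(expTilt μ h b x)
        + 2 * m i * m j * ∫ y, y j ∂(expTilt μ h b x) - m i * m j ^ 2 := by
    have I : ∀ {g : Vec d → ℝ}, Continuous g → Integrable g (expTilt μ h b x) :=
      fun hg => integrable_of_continuous_of_ae_bounded hB' hg
    simp only [← integral_const_mul]
    rw [← integral_sub (I (by fun_prop)) (I (by fun_prop)),
      ← integral_add (I (by fun_prop)) (I (by fun_prop)),
      ← integral_sub (I (by fun_prop)) (I (by fun_prop)),
      ← integral_add (I (by fun_prop)) (I (by fun_prop)),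
      show m i * m j ^ 2 = ∫ _, m i * m j ^ 2 ∂(expTilt μ h b x) by simp,
      ← integral_sub (I (by fun_prop)) (I (by fun_prop))]
    refine integral_congr_ae (ae_of_all _ fun y => ?_)
    ring
  rw [hexp]
  simp only [← hm]
  ring

lemma sum_sq_grad_laplacian_le (hB : ∀ᵐ y ∂μ, ‖y‖ ≤ B) (hh : Continuous h)
    (c k : ℝ) (x a : Vec d) :
    ∑ i, (∑ j, pd j (pd j (pd i fun z =>
      c + k * ‖z‖ ^ 2 + Real.log (expIntegral μ h b (fun _ => 1) z))) x) ^ 2 ≤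
      64 * b ^ 6 * ∫ y, ‖y - a‖ ^ 6 ∂(expTilt μ h b x) := by
  have := isProbabilityMeasure_expTilt (b := b) hB hh x
  have hB' : ∀ᵐ y ∂(expTilt μ h b x), ‖y‖ ≤ B := tilted_absolutelyContinuous _ _ hB
  let m : Vec d := WithLp.toLp 2 fun i => ∫ y, y i ∂(expTilt μ h b x)
  have hm : ∀ i, m i = ∫ y, y i ∂(expTilt μ h b x) := fun i => rfl
  have hsum : ∀ i, ∑ j, pd j (pd j (pd i fun z =>
      c + k * ‖z‖ ^ 2 + Real.log (expIntegral μ h b (fun _ => 1) z))) x =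
      b ^ 3 * ∫ y, (y i - m i) * ‖y - m‖ ^ 2 ∂(expTilt μ h b x) := by
    intro i
    simp only [pd_pd_pd_quadratic_add_log_expIntegral hB hh c k i _ x m hm]
    rw [← Finset.mul_sum, ← integral_finsetSum _ fun j _ =>
      integrable_of_continuous_of_ae_bounded hB' (by fun_prop)]
    congr 1
    refine integral_congr_ae (ae_of_all _ fun y => ?_)
    simp [EuclideanSpace.norm_sq_eq, Finset.mul_sum]
  simp only [hsum, mul_pow, ← Finset.mul_sum]
  have := sum_sq_third_central_moment_le (expTilt μ h b x) hB' a m hm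
  calc _ ≤ (b ^ 3) ^ 2 * (64 * ∫ y, ‖y - a‖ ^ 6 ∂(expTilt μ h b x)) := by gcongr
    _ = _ := by ring

end expTilt

lemma gaussianVecPDF_sub_smul {d : ℕ} {v : NNReal} (hv : v ≠ 0) (l : ℝ) (x θ : Vec d) :
    gaussianVecPDF v (x - l • θ) =
      (√(2 * π * v))⁻¹ ^ d * exp (-‖x‖ ^ 2 / (2 * v)) *
        exp (-l ^ 2 * ‖θ‖ ^ 2 / (2 * v) + l / v * inner ℝ x θ) := by
  have hv' : (v : ℝ) ≠ 0 := by exact_mod_cast hv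
  rw [gaussianVecPDF_eq, mul_assoc (_ ^ d), ← exp_add, norm_sub_sq_real, inner_smul_right, norm_smul,
    mul_pow, Real.norm_eq_abs, sq_abs]
  congr 2
  field_simp
  ring

/-- A continuous density of the forward law is the Gaussian mixture density. -/
lemma density_forwardLaw_eq {d : ℕ} (hd : 1 ≤ d) {q0 : Measure (Vec d)} [IsProbabilityMeasure q0]
    {B : ℝ} (hB : ∀ᵐ y ∂q0, ‖y‖ ≤ B) {t : ℝ} {v : NNReal} (hv : v ≠ 0)
    (hvt : (v : ℝ) = 1 - exp (-2 * t)) {r : Vec d → ℝ}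
    (hr : forwardLaw q0 t = volume.withDensity fun x => ENNReal.ofReal (r x))
    (hpos : ∀ x, 0 < r x) (hcont : Continuous r) (x : Vec d) :
    r x = (√(2 * π * v))⁻¹ ^ d * exp (-‖x‖ ^ 2 / (2 * v)) *
      expIntegral q0 (fun θ => -exp (-t) ^ 2 * ‖θ‖ ^ 2 / (2 * v)) (exp (-t) / v)
        (fun _ => 1) x := by
  set h : Vec d → ℝ := fun θ => -exp (-t) ^ 2 * ‖θ‖ ^ 2 / (2 * v) with hh_def
  set b : ℝ := exp (-t) / v
  have hh : Continuous h := by fun_prop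
  have hmix : ∀ x, ∫⁻ θ, ENNReal.ofReal (gaussianVecPDF v (x - exp (-t) • θ)) ∂q0 =
      ENNReal.ofReal ((√(2 * π * v))⁻¹ ^ d * exp (-‖x‖ ^ 2 / (2 * v)) *
        expIntegral q0 h b (fun _ => 1) x) := by
    intro x
    have hint : Integrable (fun θ => gaussianVecPDF v (x - exp (-t) • θ)) q0 :=
      integrable_of_continuous_of_ae_bounded hB
        ((continuous_gaussianVecPDF v).comp (by fun_prop))
    rw [← ofReal_integral_eq_lintegral_ofReal hint
      (ae_of_all _ fun θ => gaussianVecPDF_nonneg _ _)]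
    simp only [gaussianVecPDF_sub_smul hv, integral_const_mul, expIntegral, one_mul, hh_def, b]
  have hEcont : Continuous (expIntegral q0 h b fun _ => 1) :=
    continuous_iff_continuousAt.2 fun z =>
      (hasPd_expIntegral hB hh continuous_const ⟨0, hd⟩ z).1.continuousAt
  have hqcont : Continuous fun x : Vec d => (√(2 * π * v))⁻¹ ^ d * exp (-‖x‖ ^ 2 / (2 * v)) *
      expIntegral q0 h b (fun _ => 1) x := by fun_prop
  rw [forwardLaw_eq_withDensity q0 hv hvt, funext hmix,
    withDensity_eq_iff_of_sigmaFinite hqcont.measurable.ennreal_ofReal.aemeasurable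
      hcont.measurable.ennreal_ofReal.aemeasurable] at hr
  refine (congrFun ((hqcont.ae_eq_iff_eq volume hcont).1 ?_) x).symm
  filter_upwards [hr] with z hz
  have hE := expIntegral_one_pos (b := b) hB hh z
  exact (ENNReal.ofReal_eq_ofReal_iff (by positivity) (hpos z).le).1 hz

lemma grad_laplacian_log_density_second_moment_le {d : ℕ} (hd : 1 ≤ d) {q0 : Measure (Vec d)}
    [IsProbabilityMeasure q0] {B : ℝ} (hB : ∀ᵐ y ∂q0, ‖y‖ ≤ B) {t : ℝ} (ht : 0 < t)
    {r : Vec d → ℝ}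
    (hr : forwardLaw q0 t = volume.withDensity fun x => ENNReal.ofReal (r x))
    (hpos : ∀ x, 0 < r x) (hcont : Continuous r) :
    ∫ x, ∑ i, (∑ j, pd j (pd j (pd i (fun y => Real.log (r y)))) x) ^ 2 ∂(forwardLaw q0 t) ≤
      64 * (∫ x, x ^ 6 ∂(gaussianReal 0 1)) * (d : ℝ) ^ 3 / (1 - exp (-2 * t)) ^ 3 := by
  have hs : 0 < 1 - exp (-2 * t) := by
    rw [sub_pos, exp_lt_one_iff]
    linarith
  obtain ⟨v, hvt⟩ : ∃ v : NNReal, (v : ℝ) = 1 - exp (-2 * t) := ⟨⟨_, hs.le⟩, rfl⟩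
  rw [← hvt] at hs ⊢
  have hv : v ≠ 0 := by exact_mod_cast hs.ne'
  set l : ℝ := exp (-t)
  have hl : 0 < l := exp_pos _
  set h : Vec d → ℝ := fun θ => -l ^ 2 * ‖θ‖ ^ 2 / (2 * v)
  set b : ℝ := l / v
  set K : ℝ := ∫ x, x ^ 6 ∂(gaussianReal 0 1)
  have hK : 0 ≤ K := integral_nonneg fun x => Even.pow_nonneg ⟨3, rfl⟩ x
  have hh : Continuous h := by fun_prop
  have hreq : ∀ x, r x = (√(2 * π * v))⁻¹ ^ d * exp (-‖x‖ ^ 2 / (2 * v)) *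
      expIntegral q0 h b (fun _ => 1) x :=
    density_forwardLaw_eq hd hB hv hvt hr hpos hcont
  have hlog : (fun y => Real.log (r y)) = fun y => Real.log ((√(2 * π * v))⁻¹ ^ d) +
      -(1 / (2 * v)) * ‖y‖ ^ 2 + Real.log (expIntegral q0 h b (fun _ => 1) y) := by
    ext y
    have hE := expIntegral_one_pos (b := b) hB hh y
    rw [hreq y, Real.log_mul (by positivity) hE.ne', Real.log_mul (by positivity)
      (exp_pos _).ne', Real.log_exp]
    ring
  set F : Vec d → ℝ := fun x => ∑ i, (∑ j, pd j (pd j (pd i (fun y => Real.log (r y)))) x) ^ 2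
  have hF0 : ∀ x, 0 ≤ F x := fun x => Finset.sum_nonneg fun i _ => sq_nonneg _
  have hFr : ∀ x, r x * F x ≤
      64 / (v : ℝ) ^ 6 * ∫ θ, ‖x - l • θ‖ ^ 6 * gaussianVecPDF v (x - l • θ) ∂q0 := by
    intro x
    have hE := expIntegral_one_pos (b := b) hB hh x
    have hle : F x ≤ 64 * b ^ 6 * ∫ y, ‖y - l⁻¹ • x‖ ^ 6 ∂(expTilt q0 h b x) := by
      simp only [F, hlog]
      exact sum_sq_grad_laplacian_le hB hh _ _ x _
    refine (mul_le_mul_of_nonneg_left hle (hpos x).le).trans_eq ?_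
    rw [integral_expTilt, hreq x]
    have hpt : ∀ θ : Vec d, ‖x - l • θ‖ ^ 6 * gaussianVecPDF v (x - l • θ) =
        (√(2 * π * v))⁻¹ ^ d * exp (-‖x‖ ^ 2 / (2 * v)) * l ^ 6 *
          (‖θ - l⁻¹ • x‖ ^ 6 * exp (h θ + b * inner ℝ x θ)) := by
      intro θ
      have hnorm : ‖x - l • θ‖ = l * ‖θ - l⁻¹ • x‖ := by
        rw [norm_sub_rev, ← abs_of_pos hl, ← Real.norm_eq_abs, ← norm_smul, smul_sub,
          Real.norm_eq_abs, abs_of_pos hl, smul_inv_smul₀ hl.ne']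
      rw [hnorm, gaussianVecPDF_sub_smul hv]
      ring
    simp only [hpt, integral_const_mul]
    rw [← expIntegral, show b ^ 6 = l ^ 6 / (v : ℝ) ^ 6 from div_pow l _ 6]
    field_simp
  have hlint : ∫⁻ x, ENNReal.ofReal (F x) ∂(forwardLaw q0 t) ≤
      ENNReal.ofReal (64 * K * (d : ℝ) ^ 3 / (v : ℝ) ^ 3) := by
    have hrm : Measurable fun x => ENNReal.ofReal (r x) := hcont.measurable.ennreal_ofReal
    have hGc : Continuous fun y : Vec d => ‖y‖ ^ 6 * gaussianVecPDF v y :=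
      (by fun_prop : Continuous fun y : Vec d => ‖y‖ ^ 6).mul (continuous_gaussianVecPDF v)
    have hGm : Measurable fun y : Vec d => ENNReal.ofReal (‖y‖ ^ 6 * gaussianVecPDF v y) :=
      hGc.measurable.ennreal_ofReal
    rw [hr, lintegral_withDensity_eq_lintegral_mul_non_measurable _ hrm
      (ae_of_all _ fun x => ENNReal.ofReal_lt_top)]
    calc ∫⁻ x, ((fun x => ENNReal.ofReal (r x)) * fun x => ENNReal.ofReal (F x)) x
        ≤ ∫⁻ x, ENNReal.ofReal (64 / (v : ℝ) ^ 6) *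
            ∫⁻ θ, ENNReal.ofReal (‖x - l • θ‖ ^ 6 * gaussianVecPDF v (x - l • θ)) ∂q0 := by
          refine lintegral_mono fun x => ?_
          have hint : Integrable
              (fun θ => ‖x - l • θ‖ ^ 6 * gaussianVecPDF v (x - l • θ)) q0 :=
            integrable_of_continuous_of_ae_bounded hB
              (hGc.comp (by fun_prop : Continuous fun θ => x - l • θ))
          rw [Pi.mul_apply, ← ENNReal.ofReal_mul (hpos x).le,
            ← ofReal_integral_eq_lintegral_ofReal hint
              (ae_of_all _ fun θ => mul_nonneg (by positivity) (gaussianVecPDF_nonneg _ _)),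
            ← ENNReal.ofReal_mul (by positivity)]
          exact ENNReal.ofReal_le_ofReal (hFr x)
      _ = ENNReal.ofReal (64 / (v : ℝ) ^ 6) *
            ∫⁻ θ, (∫⁻ x, ENNReal.ofReal (‖x - l • θ‖ ^ 6 * gaussianVecPDF v (x - l • θ))) ∂q0 := by
          have hm : Measurable fun p : Vec d × Vec d =>
              ENNReal.ofReal (‖p.1 - l • p.2‖ ^ 6 * gaussianVecPDF v (p.1 - l • p.2)) :=
            hGm.comp (by fun_prop : Measurable fun p : Vec d × Vec d => p.1 - l • p.2)
          rw [lintegral_const_mul _ hm.lintegral_prod_right', lintegral_lintegral_swap]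
          exact hm.aemeasurable
      _ = ENNReal.ofReal (64 / (v : ℝ) ^ 6) *
            ∫⁻ y : Vec d, ENNReal.ofReal (‖y‖ ^ 6 * gaussianVecPDF v y) := by
          congr 1
          rw [lintegral_congr fun θ => lintegral_sub_right_eq_self
            (fun y : Vec d => ENNReal.ofReal (‖y‖ ^ 6 * gaussianVecPDF v y)) (l • θ)]
          simp
      _ ≤ ENNReal.ofReal (64 / (v : ℝ) ^ 6) *
            ENNReal.ofReal ((v : ℝ) ^ 3 * ((d : ℝ) ^ 3 * K)) := by
          gcongr
          exact gaussian_sixth_moment_norm hv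
      _ = ENNReal.ofReal (64 * K * (d : ℝ) ^ 3 / (v : ℝ) ^ 3) := by
          rw [← ENNReal.ofReal_mul (by positivity)]
          congr 1
          field_simp
  by_cases hFm : AEStronglyMeasurable F (forwardLaw q0 t)
  · rw [integral_eq_lintegral_of_nonneg_ae (ae_of_all _ hF0) hFm]
    exact ENNReal.toReal_le_of_le_ofReal (by positivity) hlint
  · rw [integral_non_aestronglyMeasurable hFm]
    positivity

/-- **Lemma (second moment of the gradient of the Laplacian of the log-density).** Under the
bounded-support assumption, `E_{X ~ q_t}[‖∇(Δ log q_t)(X)‖²] ≤ C d³ σ_t⁻⁶` for a universal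
constant `C`, where `(∇(Δ log q_t)(x))_i = Σ_j ∂_j ∂_j ∂_i log q_t(x)`. -/
theorem grad_laplacian_log_density_second_moment :
    ∃ C > (0:ℝ),
    ∀ (d : ℕ), 1 ≤ d →
    ∀ (q0 : Measure (Vec d)), IsProbabilityMeasure q0 →
    (∀ᵐ y ∂q0, ‖y‖ ≤ Real.sqrt d) →
    ∀ (ρ : ℝ → Vec d → ℝ),
    (∀ u, 0 < u → forwardLaw q0 u = volume.withDensity fun x => ENNReal.ofReal (ρ u x)) →
    (∀ u, 0 < u → ∀ x, 0 < ρ u x) →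
    (∀ u, 0 < u → ContDiff ℝ (⊤ : ℕ∞) (ρ u)) →
    ∀ (t : ℝ), 0 < t →
    ∫ x, ∑ i, (∑ j, pd j (pd j (pd i (fun y => Real.log (ρ t y)))) x)^2
        ∂(forwardLaw q0 t)
      ≤ C * (d:ℝ)^3 / (1 - Real.exp (-2*t))^3 := by
  have hK : 0 ≤ ∫ x : ℝ, x ^ 6 ∂(gaussianReal 0 1) :=
    integral_nonneg fun x => Even.pow_nonneg ⟨3, rfl⟩ x
  refine ⟨64 * (∫ x : ℝ, x ^ 6 ∂(gaussianReal 0 1)) + 1, by positivity, ?_⟩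
  intro d hd q0 hq0 hB ρ hρ hpos hsmooth t ht
  have hs : 0 < 1 - Real.exp (-2 * t) := by
    rw [sub_pos, Real.exp_lt_one_iff]
    linarith
  refine (grad_laplacian_log_density_second_moment_le hd hB ht (hρ t ht) (hpos t ht)
    (hsmooth t ht).continuous).trans ?_
  gcongr
  linarith

end
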